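/- Let (X,d) be a metric space and α : X → X a bijective isometry with eventual displacement d(α) > 0. Suppose x, x' ∈ X lie in distinct orbits of the cyclic group generated by α, i.e. x ≠ αⁿx' for all n ∈ ℤ. Then inf_{n ∈ ℤ} d(x, αⁿx') > 0; consequently there exists δ > 0 such that B_δ(x) ∩ αⁿ(B_δ(x')) = ∅ for all n ∈ ℤ. -/

import Mathlib

open Filter Topology

theorem IsometryEquiv.pow_apply_eq_iterate {X : Type*} [PseudoEMetricSpace X] (α : X ≃ᵢ X)
    (n : ℕ) (y : X) : (α ^ n) y = (⇑α)^[n] y := by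
  induction n with
  | zero => rfl
  | succ n ih => rw [pow_succ', IsometryEquiv.mul_apply, ih, Function.iterate_succ_apply']

theorem IsometryEquiv.dist_zpow_natAbs {X : Type*} [PseudoMetricSpace X] (α : X ≃ᵢ X)
    (n : ℤ) (y : X) : dist y ((α ^ n) y) = dist y ((⇑α)^[n.natAbs] y) := by
  rw [← IsometryEquiv.pow_apply_eq_iterate]
  rcases Int.natAbs_eq n with h | h
  · conv_lhs => rw [h, zpow_natCast]
  · conv_lhs => rw [h, zpow_neg, zpow_natCast]
    rw [← (α ^ n.natAbs).dist_eq y, IsometryEquiv.apply_inv_self, dist_comm]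

/-- Along the orbit of an isometry with positive eventual displacement, the distance to any
fixed point is at least `1` for all but finitely many powers. -/
theorem IsometryEquiv.exists_forall_one_le_dist_zpow {X : Type*} [PseudoMetricSpace X]
    (α : X ≃ᵢ X) {D : ℝ} (hDpos : 0 < D) (x y : X)
    (hD : Tendsto (fun n : ℕ => dist y ((⇑α)^[n] y) / n) atTop (𝓝 D)) :
    ∃ N : ℕ, ∀ n : ℤ, N ≤ n.natAbs → 1 ≤ dist x ((α ^ n) y) := by
  have hlim : Tendsto (fun n : ℕ => dist y ((⇑α)^[n] y)) atTop atTop := by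
    refine (hD.pos_mul_atTop hDpos tendsto_natCast_atTop_atTop).congr' ?_
    filter_upwards [eventually_ne_atTop 0] with n hn
    exact div_mul_cancel₀ _ (Nat.cast_ne_zero.mpr hn)
  obtain ⟨N, hN⟩ := eventually_atTop.mp (hlim.eventually_ge_atTop (1 + dist y x))
  refine ⟨N, fun n hn => ?_⟩
  have h := hN _ hn
  rw [← α.dist_zpow_natAbs] at h
  linarith [dist_triangle y x ((α ^ n) y)]

/-- For a bijective isometry `α` with eventual displacement `D > 0`, if `x` and
`x'` lie in distinct orbits of the cyclic group generated by `α`, then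
`inf_{n ∈ ℤ} d(x, αⁿx') > 0`, and consequently there is `δ > 0` with
`B_δ(x) ∩ αⁿ(B_δ(x')) = ∅` for every `n ∈ ℤ`. -/
theorem distinct_orbits_separated {X : Type*} [MetricSpace X] (α : X ≃ᵢ X) (D : ℝ)
    (hD : ∀ y : X, Tendsto (fun n : ℕ => dist y ((⇑α)^[n] y) / n) atTop (𝓝 D))
    (hDpos : 0 < D) (x x' : X) (horb : ∀ n : ℤ, x ≠ (α ^ n) x') :
    0 < ⨅ n : ℤ, dist x ((α ^ n) x') ∧
      ∃ δ > 0, ∀ n : ℤ,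
        Metric.ball x δ ∩ (⇑(α ^ n) '' Metric.ball x' δ) = ∅ := by
  obtain ⟨N, hN⟩ := α.exists_forall_one_le_dist_zpow hDpos x x' (hD x')
  obtain ⟨m, -, hm⟩ := (Finset.Icc (-(N : ℤ)) N).exists_min_image
    (fun n : ℤ => dist x ((α ^ n) x')) ⟨0, by simp⟩
  obtain ⟨c, hc, hle⟩ : ∃ c > 0, ∀ n : ℤ, c ≤ dist x ((α ^ n) x') := by
    refine ⟨min 1 (dist x ((α ^ m) x')), lt_min one_pos (dist_pos.mpr (horb m)), fun n => ?_⟩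
    by_cases hn : N ≤ n.natAbs
    · exact (min_le_left _ _).trans (hN n hn)
    · exact (min_le_right _ _).trans (hm n (Finset.mem_Icc.mpr (by omega)))
  refine ⟨hc.trans_le (le_ciInf hle), c / 2, half_pos hc, fun n => ?_⟩
  rw [Set.eq_empty_iff_forall_notMem]
  rintro _ ⟨hz, w, hw, rfl⟩
  rw [Metric.mem_ball] at hz hw
  rw [← (α ^ n).dist_eq] at hw
  linarith [hle n, dist_triangle_left x ((α ^ n) x') ((α ^ n) w)]
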